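/- Let Λ be a ring with 1 whose underlying additive group is a free ℤ-module of finite positive rank and such that Λ⊗ℚ is a semisimple ℚ-algebra, and let M be a free abelian group of finite positive rank equipped with a right Λ-module structure which is locally free of rank 1 (i.e., for every prime ℓ the right Λ⊗ℤ_ℓ-module M⊗ℤ_ℓ is free of rank 1). Then for every prime ℓ the right Λ⊗ℤ_(ℓ)-module M⊗ℤ_(ℓ) is free of rank 1, where ℤ_(ℓ) is the localization of ℤ at the prime ℓ. -/

import Mathlib

/-!
STATEMENT 0. A right module over a ring `Λ` is formalized as a module over the opposite
ring `Λᵐᵒᵖ`; accordingly, a right module over the base change `Λ ⊗ ℤ_ℓ` is formalized as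
a module over `Λᵐᵒᵖ ⊗[ℤ] ℤ_[ℓ]`.  The module structure of `Λᵐᵒᵖ ⊗[ℤ] S` on `M ⊗[ℤ] S`
(for a commutative ring `S`) is the canonical one: `Λᵐᵒᵖ` acts on the first factor and
`S` by multiplication on the second factor; it is constructed below.
"Free of rank 1" is expressed as the existence of a basis indexed by `Fin 1`.
-/

open scoped TensorProduct

namespace AlmostIso

variable (A S M : Type*) [Ring A] [CommRing S] [AddCommGroup M] [Module A M]

/-- Multiplication by elements of `S` on the second factor of `M ⊗[ℤ] S`,
as a ring homomorphism into `ℤ`-linear endomorphisms. -/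
noncomputable def rmulHom : S →+* Module.End ℤ (M ⊗[ℤ] S) where
  toFun s := LinearMap.lTensor M (LinearMap.mulLeft ℤ s)
  map_one' := by
    rw [LinearMap.mulLeft_one, LinearMap.lTensor_id]; rfl
  map_mul' s t := by
    rw [LinearMap.mulLeft_mul, LinearMap.lTensor_comp]; rfl
  map_zero' := by
    rw [LinearMap.mulLeft_zero_eq_zero, LinearMap.lTensor_zero]; rfl
  map_add' s t := by
    have h : LinearMap.mulLeft ℤ (s + t) = LinearMap.mulLeft ℤ s + LinearMap.mulLeft ℤ t := by
      ext x; simp [add_mul]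
    rw [h, LinearMap.lTensor_add]; rfl

theorem commute_lsmul_rmul (a : A) (s : S) :
    Commute ((Algebra.lsmul ℤ ℤ (M ⊗[ℤ] S) : A →ₐ[ℤ] Module.End ℤ (M ⊗[ℤ] S)) a)
      ((rmulHom S M).toIntAlgHom s) := by
  refine LinearMap.ext fun x => ?_
  induction x using TensorProduct.induction_on with
  | zero => simp [Module.End.mul_apply]
  | tmul m t =>
      change a • (m ⊗ₜ[ℤ] (s * t)) = (a • m) ⊗ₜ[ℤ] (s * t)
      simp [TensorProduct.smul_tmul']
  | add x y hx hy =>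
      simp only [Module.End.mul_apply, map_add] at hx hy ⊢
      rw [hx, hy]

/-- The base change `M ⊗[ℤ] S` of a module `M` over `A` is a module over
`A ⊗[ℤ] S`: `A` acts on the first factor and `S` by multiplication on the second. -/
noncomputable instance bcModule : Module (A ⊗[ℤ] S) (M ⊗[ℤ] S) :=
  Module.compHom _
    (Algebra.TensorProduct.lift (Algebra.lsmul ℤ ℤ (M ⊗[ℤ] S))
      (rmulHom S M).toIntAlgHom (commute_lsmul_rmul A S M)).toRingHom

end AlmostIso


/-- The localization `ℤ_(ℓ)` of `ℤ` at the prime `ℓ`, realized as the subring of `ℚ`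
of rationals that are `ℓ`-adically integral (equivalently, whose denominator is prime
to `ℓ`); one has `ℤ_(ℓ) = ℤ_ℓ ∩ ℚ` inside `ℚ_ℓ`. -/
def ZLoc (ℓ : ℕ) [Fact ℓ.Prime] : Subring ℚ where
  carrier := {q : ℚ | padicNorm ℓ q ≤ 1}
  zero_mem' := by simp [padicNorm.zero]
  one_mem' := by simp [padicNorm.one]
  add_mem' {a b} ha hb := le_trans (padicNorm.nonarchimedean) (max_le ha hb)
  mul_mem' {a b} ha hb := by
    rw [Set.mem_setOf_eq, padicNorm.mul]
    exact mul_le_one₀ ha (padicNorm.nonneg _) hb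
  neg_mem' {a} ha := by rw [Set.mem_setOf_eq, padicNorm.neg]; exact ha
namespace AlmostIso

theorem tmul_smul_tmul {A S M : Type*} [Ring A] [CommRing S] [AddCommGroup M] [Module A M]
    (a : A) (s : S) (m : M) (t : S) :
    (a ⊗ₜ[ℤ] s : A ⊗[ℤ] S) • (m ⊗ₜ[ℤ] t : M ⊗[ℤ] S) = (a • m) ⊗ₜ[ℤ] (s * t) := by
  change (Algebra.TensorProduct.lift (Algebra.lsmul ℤ ℤ (M ⊗[ℤ] S))
      (rmulHom S M).toIntAlgHom (commute_lsmul_rmul A S M) (a ⊗ₜ[ℤ] s)) (m ⊗ₜ[ℤ] t) = _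
  rw [Algebra.TensorProduct.lift_tmul]
  change a • (m ⊗ₜ[ℤ] (s * t)) = _
  rw [TensorProduct.smul_tmul']

/-- The additive orbit map `a ↦ a • m`. -/
def orbitMap (A : Type*) {M : Type*} [Ring A] [AddCommGroup M] [Module A M] (m : M) :
    A →ₗ[ℤ] M :=
  ((LinearMap.toSpanSingleton A M m).toAddMonoidHom).toIntLinearMap

theorem orbitMap_apply {A M : Type*} [Ring A] [AddCommGroup M] [Module A M] (m : M) (a : A) :
    orbitMap A m a = a • m := rfl

theorem smul_tmul_one_eq_rTensor {A S M : Type*} [Ring A] [CommRing S] [AddCommGroup M]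
    [Module A M] (m : M) (α : A ⊗[ℤ] S) :
    α • (m ⊗ₜ[ℤ] (1 : S)) = (orbitMap A m).rTensor S α := by
  induction α using TensorProduct.induction_on with
  | zero => exact (zero_smul (A ⊗[ℤ] S) _).trans (map_zero ((orbitMap A m).rTensor S)).symm
  | tmul a s => simp [tmul_smul_tmul, orbitMap_apply]
  | add x y hx hy => rw [add_smul, hx, hy, map_add]

/-- If `r • N` lies in the range of `f` and `r` is a unit of `S`, then `f ⊗ S` is surjective. -/
theorem rTensor_surjective_of_smul_mem_range {N M S : Type*} [AddCommGroup N] [AddCommGroup M]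
    [CommRing S] (f : N →ₗ[ℤ] M) (r : ℤ) (hr : IsUnit (r : S))
    (h : ∀ y, r • y ∈ LinearMap.range f) : Function.Surjective (f.rTensor S) := by
  rw [← LinearMap.range_eq_top, eq_top_iff]
  rintro z -
  induction z using TensorProduct.induction_on with
  | zero => exact zero_mem _
  | add x y hx hy => exact add_mem hx hy
  | tmul y s =>
    obtain ⟨u, hu⟩ := hr
    obtain ⟨a, ha⟩ := h y
    refine ⟨a ⊗ₜ ((↑u⁻¹ : S) * s), ?_⟩
    rw [LinearMap.rTensor_tmul, ha, TensorProduct.smul_tmul, zsmul_eq_mul, ← hu,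
      Units.mul_inv_cancel_left]

theorem exists_tmul_one_add_smul {ℓ : ℕ} [Fact ℓ.Prime] {M : Type*} [AddCommGroup M]
    (z : M ⊗[ℤ] ℤ_[ℓ]) : ∃ (m : M) (w : M ⊗[ℤ] ℤ_[ℓ]), z = m ⊗ₜ 1 + (ℓ : ℤ) • w := by
  induction z using TensorProduct.induction_on with
  | zero => exact ⟨0, 0, by simp⟩
  | add x y hx hy =>
    obtain ⟨m, w, rfl⟩ := hx
    obtain ⟨n, v, rfl⟩ := hy
    exact ⟨m + n, w + v, by rw [TensorProduct.add_tmul, smul_add]; abel⟩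
  | tmul y s =>
    obtain ⟨n, -, hn⟩ := PadicInt.exists_mem_range (p := ℓ) s
    rw [PadicInt.maximalIdeal_eq_span_p, Ideal.mem_span_singleton] at hn
    obtain ⟨t, ht⟩ := hn
    refine ⟨(n : ℤ) • y, y ⊗ₜ t, ?_⟩
    rw [TensorProduct.smul_tmul, ← TensorProduct.tmul_smul, ← TensorProduct.tmul_add]
    congr 1
    rw [zsmul_eq_mul, zsmul_eq_mul, mul_one]
    push_cast
    rw [← ht]
    ring

theorem exists_smul_of_tmul_one_eq_smul {ℓ : ℕ} [Fact ℓ.Prime] {M : Type*} [AddCommGroup M]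
    [Module.Free ℤ M] (y : M) (w : M ⊗[ℤ] ℤ_[ℓ])
    (h : y ⊗ₜ[ℤ] (1 : ℤ_[ℓ]) = (ℓ : ℤ) • w) : ∃ v : M, y = (ℓ : ℤ) • v := by
  let b := Module.Free.chooseBasis ℤ M
  have hdvd (i) : (ℓ : ℤ) ∣ b.repr y i := by
    have := congrArg (fun z => TensorProduct.lid ℤ ℤ_[ℓ] ((b.coord i).rTensor ℤ_[ℓ] z)) h
    rw [map_zsmul, map_zsmul] at this
    simp only [LinearMap.rTensor_tmul, TensorProduct.lid_tmul, zsmul_eq_mul, mul_one,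
      Module.Basis.coord_apply, Int.cast_natCast] at this
    rw [← PadicInt.norm_int_lt_one_iff_dvd, this, ← PadicInt.mem_nonunits,
      ← IsLocalRing.mem_maximalIdeal,
      PadicInt.maximalIdeal_eq_span_p, Ideal.mem_span_singleton]
    exact dvd_mul_right _ _
  choose c hc using hdvd
  refine ⟨∑ i ∈ (b.repr y).support, c i • b i, ?_⟩
  conv_lhs => rw [← b.linearCombination_repr y, Finsupp.linearCombination_apply, Finsupp.sum]
  rw [Finset.smul_sum]
  exact Finset.sum_congr rfl fun i _ => by rw [hc, mul_smul]

theorem isNoetherianRing_tensorProduct (A S : Type*) [Ring A] [CommRing S] [Module.Finite ℤ A]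
    [IsNoetherianRing S] : IsNoetherianRing (A ⊗[ℤ] S) := by
  have : IsNoetherianRing (S ⊗[ℤ] A) := isNoetherian_of_tower S inferInstance
  exact isNoetherianRing_of_ringEquiv (S ⊗[ℤ] A)
    (Algebra.TensorProduct.comm ℤ S A).toRingEquiv

/-- If `M ⊗ ℤ_ℓ` is free of rank one over `A ⊗ ℤ_ℓ`, some `m : M` has an injective orbit map
whose range contains `r • M` for an integer `r` prime to `ℓ`. -/
theorem exists_orbitMap_injective_and_smul_mem_range {ℓ : ℕ} [Fact ℓ.Prime] {A M : Type*} [Ring A]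
    [Module.Free ℤ A] [Module.Finite ℤ A] [AddCommGroup M] [Module A M] [Module.Free ℤ M]
    [Module.Finite ℤ M]
    (b : Module.Basis (Fin 1) (A ⊗[ℤ] ℤ_[ℓ]) (M ⊗[ℤ] ℤ_[ℓ])) :
    ∃ (m : M) (r : ℤ), ¬ (ℓ : ℤ) ∣ r ∧ Function.Injective (orbitMap A m) ∧
      ∀ y, r • y ∈ LinearMap.range (orbitMap A m) := by
  obtain ⟨m, w, hm⟩ := exists_tmul_one_add_smul (b 0)
  have hgen (y : M) : ∃ (a : A) (v : M), y = a • m + (ℓ : ℤ) • v := by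
    obtain ⟨α, hα⟩ : ∃ α : A ⊗[ℤ] ℤ_[ℓ], α • b 0 = y ⊗ₜ 1 :=
      ⟨b.repr (y ⊗ₜ 1) 0, by simpa using b.sum_repr (y ⊗ₜ 1)⟩
    obtain ⟨a, β, hβ⟩ := exists_tmul_one_add_smul α
    obtain ⟨v, hv⟩ := exists_smul_of_tmul_one_eq_smul (ℓ := ℓ) (y - a • m)
      ((a ⊗ₜ[ℤ] (1 : ℤ_[ℓ])) • w + β • b 0) (by
        rw [TensorProduct.sub_tmul, ← hα, hβ, add_smul, smul_assoc]
        nth_rewrite 1 [hm]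
        rw [smul_add, tmul_smul_tmul, mul_one, smul_comm _ (ℓ : ℤ) w, smul_add]
        abel)
    exact ⟨a, v, by rw [← hv]; abel⟩
  obtain ⟨r, hr, hrM⟩ := Submodule.exists_sub_one_mem_and_smul_eq_zero_of_fg_of_le_smul
    (Ideal.span {(ℓ : ℤ)}) (⊤ : Submodule ℤ (M ⧸ LinearMap.range (orbitMap A m)))
    Module.Finite.fg_top (by
      rintro x -
      obtain ⟨y, rfl⟩ := Submodule.Quotient.mk_surjective _ x
      obtain ⟨a, v, rfl⟩ := hgen y
      rw [Submodule.Quotient.mk_add, (Submodule.Quotient.mk_eq_zero _).2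
        (show a • m ∈ LinearMap.range (orbitMap A m) from ⟨a, rfl⟩),
        zero_add,
        Submodule.Quotient.mk_smul]
      exact Submodule.smul_mem_smul (Ideal.mem_span_singleton_self _) trivial)
  rw [Ideal.mem_span_singleton] at hr
  have hrange (y : M) : r • y ∈ LinearMap.range (orbitMap A m) := by
    rw [← Submodule.Quotient.mk_eq_zero, Submodule.Quotient.mk_smul]
    exact hrM _ trivial
  have hndvd : ¬ (ℓ : ℤ) ∣ r := fun hdvd => by
    have h1 : (ℓ : ℤ) ∣ 1 := by simpa using dvd_sub hdvd hr
    exact (Nat.Prime.one_lt (Fact.out : ℓ.Prime)).ne'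
      (by exact_mod_cast Int.eq_one_of_dvd_one (by positivity) h1)
  refine ⟨m, r, hndvd, ?_, hrange⟩
  have hunit : IsUnit (r : ℤ_[ℓ]) := by
    rw [PadicInt.isUnit_iff]
    refine le_antisymm (PadicInt.norm_le_one _) (not_lt.1 fun hlt => ?_)
    exact hndvd ((PadicInt.norm_int_lt_one_iff_dvd r).1 hlt)
  have hsurj := rTensor_surjective_of_smul_mem_range (S := ℤ_[ℓ]) _ r hunit hrange
  have := isNoetherianRing_tensorProduct A ℤ_[ℓ]
  let e := b.repr ≪≫ₗ Finsupp.uniqueLinearEquiv (A ⊗[ℤ] ℤ_[ℓ]) (A ⊗[ℤ] ℤ_[ℓ]) (0 : Fin 1)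
  let g : (A ⊗[ℤ] ℤ_[ℓ]) →ₗ[A ⊗[ℤ] ℤ_[ℓ]] (A ⊗[ℤ] ℤ_[ℓ]) :=
    e.toLinearMap ∘ₗ LinearMap.toSpanSingleton _ _ (m ⊗ₜ[ℤ] (1 : ℤ_[ℓ]))
  have hg (α) : g α = e ((orbitMap A m).rTensor ℤ_[ℓ] α) :=
    congrArg e (smul_tmul_one_eq_rTensor m α)
  have hginj : Function.Injective g :=
    OrzechProperty.injective_of_surjective_endomorphism g fun z => by
      obtain ⟨α, hα⟩ := hsurj (e.symm z)
      exact ⟨α, by rw [hg, hα, e.apply_symm_apply]⟩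
  intro a a' haa
  have hinj : Function.Injective ((TensorProduct.mk ℤ A ℤ_[ℓ]).flip 1) := by
    have := Module.Flat.lTensor_preserves_injective_linearMap (M := A)
      (Algebra.linearMap ℤ ℤ_[ℓ]) (algebraMap ℤ ℤ_[ℓ]).injective_int
    have h2 := this.comp (TensorProduct.rid ℤ A).symm.injective
    intro x y hxy
    exact h2 (by simpa using hxy)
  apply hinj
  apply hginj
  rw [hg, hg]
  simp [haa]

/-- A base change along a flat ring in which `r` is invertible turns an orbit map that is
injective with range containing `r • M` into a free generator. -/
theorem nonempty_basis_of_orbitMap {A S M : Type*} [Ring A] [CommRing S] [AddCommGroup M]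
    [Module A M] [Module.Flat ℤ S] (m : M) (r : ℤ) (hr : IsUnit (r : S))
    (hinj : Function.Injective (orbitMap A m))
    (hrange : ∀ y, r • y ∈ LinearMap.range (orbitMap A m)) :
    Nonempty (Module.Basis (Fin 1) (A ⊗[ℤ] S) (M ⊗[ℤ] S)) := by
  let g : (A ⊗[ℤ] S) →ₗ[A ⊗[ℤ] S] (M ⊗[ℤ] S) :=
    LinearMap.toSpanSingleton _ _ (m ⊗ₜ[ℤ] (1 : S))
  have hg : (g : A ⊗[ℤ] S → M ⊗[ℤ] S) = (orbitMap A m).rTensor S :=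
    funext fun α => smul_tmul_one_eq_rTensor m α
  have hbij : Function.Bijective g := by
    rw [hg]
    exact ⟨Module.Flat.rTensor_preserves_injective_linearMap _ hinj,
      rTensor_surjective_of_smul_mem_range _ r hr hrange⟩
  exact ⟨(Module.Basis.singleton (Fin 1) (A ⊗[ℤ] S)).map (LinearEquiv.ofBijective g hbij)⟩

end AlmostIso

theorem ZLoc.isUnit_intCast {ℓ : ℕ} [Fact ℓ.Prime] {r : ℤ} (hr : ¬ (ℓ : ℤ) ∣ r) :
    IsUnit (r : ZLoc ℓ) := by
  have hnorm : padicNorm ℓ (r : ℚ) = 1 := (padicNorm.int_eq_one_iff r).2 hr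
  have h0 : (r : ℚ) ≠ 0 := fun h => by simp [h] at hnorm
  have hmem : (r : ℚ)⁻¹ ∈ ZLoc ℓ := by
    change padicNorm ℓ (r : ℚ)⁻¹ ≤ 1
    rw [← one_div, padicNorm.div, hnorm, padicNorm.one, div_one]
  refine IsUnit.of_mul_eq_one ⟨(r : ℚ)⁻¹, hmem⟩ (Subtype.ext ?_)
  simp [h0]

open AlmostIso in
/-- Let `Λ` be a ring whose underlying additive group is a free `ℤ`-module of finite
positive rank, such that `Λ ⊗ ℚ` is a semisimple `ℚ`-algebra, and let `M` be a free
abelian group of finite positive rank with a right `Λ`-module structure which is locally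
free of rank `1` (for every prime `ℓ` the right `Λ ⊗ ℤ_ℓ`-module `M ⊗ ℤ_ℓ` is free of
rank `1`).  Then for every prime `ℓ` the right `Λ ⊗ ℤ_(ℓ)`-module `M ⊗ ℤ_(ℓ)` is free
of rank `1`, where `ℤ_(ℓ)` is the localization of `ℤ` at `ℓ`. -/
theorem localized_base_change_free_of_rank_one_of_locally_free_rank_one
    (Λ M : Type) [Ring Λ]
    [Module.Free ℤ Λ] [Module.Finite ℤ Λ] (hΛrank : 0 < Module.finrank ℤ Λ)
    [IsSemisimpleRing (Λ ⊗[ℤ] ℚ)]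
    [AddCommGroup M] [Module Λᵐᵒᵖ M]
    [Module.Free ℤ M] [Module.Finite ℤ M] (hMrank : 0 < Module.finrank ℤ M)
    (hloc : ∀ (ℓ : ℕ) [Fact ℓ.Prime],
      Nonempty (Module.Basis (Fin 1) (Λᵐᵒᵖ ⊗[ℤ] ℤ_[ℓ]) (M ⊗[ℤ] ℤ_[ℓ]))) :
    ∀ (ℓ : ℕ) [Fact ℓ.Prime],
      Nonempty (Module.Basis (Fin 1) (Λᵐᵒᵖ ⊗[ℤ] (ZLoc ℓ)) (M ⊗[ℤ] (ZLoc ℓ))) := by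
  intro ℓ _
  obtain ⟨b⟩ := hloc ℓ
  obtain ⟨m, r, hr, hinj, hrange⟩ := exists_orbitMap_injective_and_smul_mem_range b
  exact nonempty_basis_of_orbitMap m r (ZLoc.isUnit_intCast hr) hinj hrange
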